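/- Let D be a Hamiltonian strongly connected balanced bipartite digraph of order 2a (a ≥ 3, k an integer with max{1,a/4} < k ≤ a/2) satisfying: for every dominating pair {u,v}, either d(u) ≥ 2a−k and d(v) ≥ a+k, or d(u) ≥ a+k and d(v) ≥ 2a−k. Suppose D is not bipancyclic and not a directed cycle of length 2a. If {u,v} is a non-dominating pair of vertices in the same partite set, then d(u) < 2a−k and d(v) < 2a−k. -/

import Mathlib

open Finset Function

variable {V : Type*}

/-- Out-degree of a vertex in a digraph given by arc relation `A`. -/
noncomputable def outDeg (A : V → V → Prop) (u : V) : ℕ := {v | A u v}.ncard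

/-- In-degree of a vertex. -/
noncomputable def inDeg (A : V → V → Prop) (u : V) : ℕ := {v | A v u}.ncard

/-- Degree `d(u) = d⁺(u) + d⁻(u)`. -/
noncomputable def deg (A : V → V → Prop) (u : V) : ℕ := outDeg A u + inDeg A u

/-- Strong connectedness: a directed path between every ordered pair of vertices. -/
def StronglyConnected (A : V → V → Prop) : Prop :=
  ∀ u v : V, Relation.ReflTransGen A u v

/-- `X, Y` form a bipartition of the digraph `A`. -/
def IsBipartition (A : V → V → Prop) (X Y : Set V) : Prop :=
  Disjoint X Y ∧ X ∪ Y = Set.univ ∧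
    ∀ u v, A u v → (u ∈ X ∧ v ∈ Y) ∨ (u ∈ Y ∧ v ∈ X)

/-- `{u,v}` is a dominating pair: a common out-neighbour exists. -/
def IsDominatingPair (A : V → V → Prop) (u v : V) : Prop :=
  u ≠ v ∧ ∃ w, A u w ∧ A v w

/-- `{u,v}` is a dominated pair: a common in-neighbour exists. -/
def IsDominatedPair (A : V → V → Prop) (u v : V) : Prop :=
  u ≠ v ∧ ∃ w, A w u ∧ A w v

/-- The digraph contains a directed cycle of length `l`. -/
def HasCycleOfLength (A : V → V → Prop) (l : ℕ) : Prop :=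
  ∃ f : ZMod l → V, Function.Injective f ∧ ∀ i, A (f i) (f (i + 1))

/-- The digraph contains a Hamiltonian (directed) cycle. -/
def IsHamiltonian [Fintype V] (A : V → V → Prop) : Prop :=
  ∃ f : ZMod (Fintype.card V) ≃ V, ∀ i, A (f i) (f (i + 1))

/-- The digraph is exactly one directed cycle through all its vertices. -/
def IsDirectedCycleDigraph [Fintype V] (A : V → V → Prop) : Prop :=
  ∃ f : ZMod (Fintype.card V) ≃ V, ∀ u v, A u v ↔ ∃ i, u = f i ∧ v = f (i + 1)

/-- A balanced bipartite digraph of order `2a` is bipancyclic: it has cycles of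
all even lengths `2, 4, …, 2a`. -/
def Bipancyclic [Fintype V] (A : V → V → Prop) (a : ℕ) : Prop :=
  ∀ l, 1 ≤ l → l ≤ a → HasCycleOfLength A (2 * l)

/-- A digraph is pancyclic: cycles of all lengths `2, …, n`. -/
def Pancyclic [Fintype V] (A : V → V → Prop) : Prop :=
  ∀ l, 2 ≤ l → l ≤ Fintype.card V → HasCycleOfLength A l

/-- A cycle factor: a spanning collection of vertex-disjoint directed cycles,
i.e. a permutation `σ` with `v → σ v` an arc for every `v` (in a loopless
digraph all orbits have length `≥ 2`). -/
def HasCycleFactor (A : V → V → Prop) : Prop :=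
  ∃ σ : Equiv.Perm V, ∀ v, A v (σ v)

/-- `arcs(S,T) = |A[S,T]| + |A[T,S]|`. -/
noncomputable def arcsCount (A : V → V → Prop) (S T : Set V) : ℕ :=
  {p : V × V | p.1 ∈ S ∧ p.2 ∈ T ∧ A p.1 p.2}.ncard +
  {p : V × V | p.1 ∈ T ∧ p.2 ∈ S ∧ A p.1 p.2}.ncard

section Bipartition

variable {A : V → V → Prop} {X Y : Set V} {u v : V}

theorem IsBipartition.symm (h : IsBipartition A X Y) : IsBipartition A Y X :=
  ⟨h.1.symm, by rw [Set.union_comm]; exact h.2.1, fun u v huv => (h.2.2 u v huv).symm⟩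

theorem IsBipartition.mem_of_arc_left (h : IsBipartition A X Y) (hu : u ∈ X) (huv : A u v) :
    v ∈ Y :=
  (h.2.2 u v huv).elim (·.2) fun h' => (Set.disjoint_left.1 h.1 hu h'.1).elim

theorem IsBipartition.mem_of_arc_right (h : IsBipartition A X Y) (hv : v ∈ X) (huv : A u v) :
    u ∈ Y :=
  (h.2.2 u v huv).elim (fun h' => (Set.disjoint_left.1 h.1 hv h'.2).elim) (·.1)

theorem IsBipartition.outDeg_le [Finite V] (h : IsBipartition A X Y) (hu : u ∈ X) :
    outDeg A u ≤ Y.ncard :=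
  Set.ncard_le_ncard (fun _ hw => h.mem_of_arc_left hu hw) (Set.toFinite _)

theorem IsBipartition.inDeg_le [Finite V] (h : IsBipartition A X Y) (hu : u ∈ X) :
    inDeg A u ≤ Y.ncard :=
  Set.ncard_le_ncard (fun _ hw => h.mem_of_arc_right hu hw) (Set.toFinite _)

theorem IsBipartition.arc_of_inDeg_eq [Finite V] (h : IsBipartition A X Y) (hu : u ∈ X)
    (hd : Y.ncard ≤ inDeg A u) {w : V} (hw : w ∈ Y) : A w u := by
  have : {x | A x u} = Y :=
    Set.eq_of_subset_of_ncard_le (fun _ hx => h.mem_of_arc_right hu hx) hd (Set.toFinite _)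
  exact this.symm.subset hw

theorem IsBipartition.outDeg_add_outDeg_le [Finite V] (h : IsBipartition A X Y) (hu : u ∈ X)
    (hv : v ∈ X) (huv : ¬ ∃ w, A u w ∧ A v w) : outDeg A u + outDeg A v ≤ Y.ncard := by
  have hdisj : Disjoint {w | A u w} {w | A v w} :=
    Set.disjoint_left.2 fun w h1 h2 => huv ⟨w, h1, h2⟩
  rw [outDeg, outDeg, ← Set.ncard_union_eq hdisj (Set.toFinite _) (Set.toFinite _)]
  exact Set.ncard_le_ncard (Set.union_subset (fun _ hw => h.mem_of_arc_left hu hw)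
    fun _ hw => h.mem_of_arc_left hv hw) (Set.toFinite _)

/-- The vertices of an infinite walk alternate between the two partite sets. -/
theorem IsBipartition.mem_of_walk (h : IsBipartition A X Y) {p : ℕ → V}
    (hp : ∀ n, A (p n) (p (n + 1))) (h0 : p 0 ∈ X) (m : ℕ) :
    p (2 * m) ∈ X ∧ p (2 * m + 1) ∈ Y := by
  induction m with
  | zero => exact ⟨h0, h.mem_of_arc_left h0 (hp 0)⟩
  | succ m ih =>
    have h1 : p (2 * (m + 1)) ∈ X := h.symm.mem_of_arc_left ih.2 (hp _)
    exact ⟨h1, h.mem_of_arc_left h1 (hp _)⟩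

/-- A Hamiltonian bipartite digraph with a vertex dominated by the whole opposite partite set is
bipancyclic. -/
theorem IsBipartition.bipancyclic_of_dominated [Fintype V] (h : IsBipartition A X Y) {a : ℕ}
    (hcard : Fintype.card V = 2 * a) (hham : IsHamiltonian A) (hu : u ∈ X)
    (hdom : ∀ w ∈ Y, A w u) : Bipancyclic A a := by
  intro l hl hla
  obtain ⟨f, hf⟩ := hham
  obtain ⟨s, rfl⟩ := f.surjective u
  have hwalk : ∀ n : ℕ, A (f (s + (n : ℕ))) (f (s + ((n + 1 : ℕ) : ZMod (Fintype.card V)))) := by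
    intro n
    have := hf (s + (n : ℕ))
    rwa [add_assoc, ← Nat.cast_succ] at this
  have halt := h.mem_of_walk (p := fun n => f (s + (n : ZMod (Fintype.card V)))) hwalk
    (by simpa using hu)
  have : NeZero (2 * l) := ⟨by omega⟩
  have : Fact (1 < 2 * l) := ⟨by omega⟩
  refine ⟨fun i => f (s + (i.val : ℕ)), fun i j hij => ?_, fun i => ?_⟩
  · have hi := i.val_lt
    have hj := j.val_lt
    have hij' := (ZMod.natCast_eq_natCast_iff' _ _ _).1 (add_left_cancel (f.injective hij))
    rw [Nat.mod_eq_of_lt (by omega), Nat.mod_eq_of_lt (by omega)] at hij'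
    exact ZMod.val_injective _ hij'
  · have hi := i.val_lt
    by_cases hlast : i.val + 1 = 2 * l
    · have hsucc : (i + 1).val = 0 := by
        rw [ZMod.val_add, ZMod.val_one, hlast, Nat.mod_self]
      have hY := (halt (l - 1)).2
      rw [show 2 * (l - 1) + 1 = i.val by omega] at hY
      simpa [hsucc] using hdom _ hY
    · have hsucc : (i + 1).val = i.val + 1 := by
        rw [ZMod.val_add, ZMod.val_one, Nat.mod_eq_of_lt (by omega)]
      simpa only [hsucc] using hwalk i.val

theorem IsBipartition.deg_le_of_inDeg_le_one [Finite V] (h : IsBipartition A X Y) {a : ℕ}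
    (hX : X.ncard = a) (hY : Y.ncard = a) (hu : inDeg A u ≤ 1) : deg A u ≤ a + 1 := by
  have hout : outDeg A u ≤ a := by
    rcases (h.2.1.symm.subset (Set.mem_univ u) : u ∈ X ∪ Y) with hu' | hu'
    · exact hY ▸ h.outDeg_le hu'
    · exact hX ▸ h.symm.outDeg_le hu'
  exact add_le_add hout hu

end Bipartition

/-- A Hamiltonian digraph without dominating pairs is a directed cycle. -/
theorem IsHamiltonian.isDirectedCycleDigraph [Fintype V] {A : V → V → Prop}
    (hham : IsHamiltonian A) (h : ∀ u v, ¬ IsDominatingPair A u v) :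
    IsDirectedCycleDigraph A := by
  obtain ⟨f, hf⟩ := hham
  refine ⟨f, fun u v => ⟨fun huv => ?_, ?_⟩⟩
  · obtain ⟨j, rfl⟩ := f.surjective v
    have hj := hf (j - 1)
    rw [sub_add_cancel] at hj
    refine ⟨j - 1, ?_, by rw [sub_add_cancel]⟩
    by_contra hne
    exact h _ _ ⟨hne, _, huv, hj⟩
  · rintro ⟨i, rfl, rfl⟩
    exact hf i

/-- If both vertices of each dominating pair have degree at least `d > a + 1`, then all vertices of
a strongly connected Hamiltonian balanced bipartite digraph other than a directed cycle do. -/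
theorem IsBipartition.le_deg [Fintype V] {A : V → V → Prop} {X Y : Set V} {a d : ℕ}
    (h : IsBipartition A X Y) (hX : X.ncard = a) (hY : Y.ncard = a)
    (hsc : StronglyConnected A) (hd : a + 1 < d)
    (hdeg : ∀ u v, IsDominatingPair A u v → d ≤ deg A u)
    (hham : IsHamiltonian A) (hnc : ¬ IsDirectedCycleDigraph A) (p : V) : d ≤ deg A p := by
  by_contra! hp
  have hstep : ∀ q w, deg A q < d → A q w → deg A w < d := by
    intro q w hq hqw
    refine (h.deg_le_of_inDeg_le_one hX hY ?_).trans_lt hd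
    have hsub : {x | A x w} ⊆ {q} := by
      intro x hx
      by_contra hne
      exact hq.not_ge (hdeg q x ⟨fun e => hne e.symm, w, hqw, hx⟩)
    simpa [inDeg] using Set.ncard_le_ncard hsub (Set.finite_singleton q)
  have hall : ∀ w, deg A w < d := by
    intro w
    induction hsc p w with
    | refl => exact hp
    | tail _ hqw ih => exact hstep _ _ ih hqw
  exact hnc (hham.isDirectedCycleDigraph fun u v huv => (hall u).not_ge (hdeg u v huv))

/-- If `u, v` is a non-dominating pair in one partite set whose degree sum is at least `3a`, then
the whole opposite partite set dominates `u`, so the digraph is bipancyclic. -/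
theorem IsBipartition.bipancyclic_of_nonDominating [Fintype V] {A : V → V → Prop} {X Y : Set V}
    {a : ℕ} {u v : V} (h : IsBipartition A X Y) (hY : Y.ncard = a)
    (hcard : Fintype.card V = 2 * a) (hham : IsHamiltonian A) (hu : u ∈ X) (hv : v ∈ X)
    (huv : ¬ ∃ w, A u w ∧ A v w) (hsum : 3 * a ≤ deg A u + deg A v) : Bipancyclic A a := by
  have h1 := h.outDeg_add_outDeg_le hu hv huv
  have h2 := h.inDeg_le hv
  unfold deg at hsum
  exact h.bipancyclic_of_dominated hcard hham hu fun _ =>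
    h.arc_of_inDeg_eq hu (by omega)

/-- under the same hypotheses, a non-dominating pair of vertices in
the same partite set has both degrees `< 2a−k`. -/
theorem stmt_16 {V : Type*} [Fintype V] (A : V → V → Prop) (a k : ℕ) (X Y : Set V)
    (ha : 3 ≤ a) (hk1 : 1 < k) (hk2 : a < 4 * k) (hk3 : 2 * k ≤ a)
    (hcard : Fintype.card V = 2 * a)
    (hbip : IsBipartition A X Y) (hX : X.ncard = a) (hY : Y.ncard = a)
    (hsc : StronglyConnected A)
    (hdeg : ∀ u v : V, IsDominatingPair A u v →
      (2 * a - k ≤ deg A u ∧ a + k ≤ deg A v) ∨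
      (a + k ≤ deg A u ∧ 2 * a - k ≤ deg A v))
    (hham : IsHamiltonian A) (hnb : ¬ Bipancyclic A a)
    (hnc : ¬ IsDirectedCycleDigraph A) :
    ∀ u v : V, u ≠ v → ((u ∈ X ∧ v ∈ X) ∨ (u ∈ Y ∧ v ∈ Y)) →
      ¬ (∃ w, A u w ∧ A v w) →
      deg A u < 2 * a - k ∧ deg A v < 2 * a - k := by
  have hmin := hbip.le_deg hX hY hsc (show a + 1 < a + k by omega)
    (fun u v huv => by rcases hdeg u v huv with h | h <;> omega) hham hnc
  intro u v _ hmem huv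
  have hsum : deg A u + deg A v < 3 * a := by
    by_contra! hsum
    rcases hmem with ⟨hu, hv⟩ | ⟨hu, hv⟩
    · exact hnb (hbip.bipancyclic_of_nonDominating hY hcard hham hu hv huv hsum)
    · exact hnb (hbip.symm.bipancyclic_of_nonDominating hX hcard hham hu hv huv hsum)
  have hdu := hmin u
  have hdv := hmin v
  omega
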